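/- arXiv:1001.0555 — 2 statements merged into one kernel-verified Lean document; each statement's English description precedes it below -/
import Mathlib

section
/- Let V be a finite vertex set, let T be a tree on V of depth at most 2, i.e., there is a vertex r of T such that every vertex of V is at T-graph-distance at most 2 from r, and let P be any path graph on V. Then T and P admit a geometric simultaneous embedding: there exists an injective map p : V → ℝ² that is simultaneously a planar straight-line drawing of T and a planar straight-line drawing of P. -/
/-- A planar straight-line drawing of a simple graph `G`: an injective map into the plane
such that any two distinct edges, drawn as closed segments, meet at most in the images of
common endpoints. -/
def IsPlanarDrawing {V : Type*} (G : SimpleGraph V) (p : V → ℝ × ℝ) : Prop :=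
  Function.Injective p ∧
    ∀ a b c d : V, G.Adj a b → G.Adj c d → s(a, b) ≠ s(c, d) →
      segment ℝ (p a) (p b) ∩ segment ℝ (p c) (p d) ⊆ p '' ({a, b} ∩ {c, d} : Set V)

/-- `P` is a path graph: there is an ordering of all the vertices such that the edges of `P`
are exactly the pairs of consecutive vertices. -/
def IsPathGraph {V : Type*} [Fintype V] (P : SimpleGraph V) : Prop :=
  ∃ v : Fin (Fintype.card V) ≃ V, ∀ a b : V,
    P.Adj a b ↔ ((v.symm a : ℕ) + 1 = (v.symm b : ℕ) ∨ (v.symm b : ℕ) + 1 = (v.symm a : ℕ))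

namespace GSE

/-- The value of an affine functional at a point. -/
def aff (u v w : ℝ) (x : ℝ × ℝ) : ℝ := u * x.1 + v * x.2 + w

/-- The two segments meet only in images of common endpoints. -/
def Ok {V : Type*} (p : V → ℝ × ℝ) (a b c d : V) : Prop :=
  segment ℝ (p a) (p b) ∩ segment ℝ (p c) (p d) ⊆ p '' ({a, b} ∩ {c, d} : Set V)

lemma Ok.swapl {V : Type*} {p : V → ℝ × ℝ} {a b c d : V} (h : Ok p a b c d) : Ok p b a c d := by
  unfold Ok at *
  rw [segment_symm, Set.pair_comm b a]
  exact h

lemma Ok.swap {V : Type*} {p : V → ℝ × ℝ} {a b c d : V} (h : Ok p a b c d) : Ok p c d a b := by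
  unfold Ok at *
  rw [Set.inter_comm, Set.inter_comm {c, d}]
  exact h

lemma Ok.swapr {V : Type*} {p : V → ℝ × ℝ} {a b c d : V} (h : Ok p a b c d) : Ok p a b d c :=
  h.swap.swapl.swap

lemma aff_comb (u v w : ℝ) (a b x : ℝ × ℝ) (hx : x ∈ segment ℝ a b) :
    ∃ α β : ℝ, 0 ≤ α ∧ 0 ≤ β ∧ α + β = 1 ∧ α • a + β • b = x ∧
      aff u v w x = α * aff u v w a + β * aff u v w b := by
  obtain ⟨α, β, h1, h2, h3, h4⟩ := hx
  refine ⟨α, β, h1, h2, h3, h4, ?_⟩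
  rw [← h4]
  simp only [aff, Prod.fst_add, Prod.snd_add, Prod.smul_fst, Prod.smul_snd, smul_eq_mul]
  have : β = 1 - α := by linarith
  subst this
  ring

/-- Strict separation. -/
lemma ok_sep {V : Type*} {p : V → ℝ × ℝ} {a b c d : V} (u v w : ℝ)
    (ha : aff u v w (p a) < 0) (hb : aff u v w (p b) < 0)
    (hc : 0 ≤ aff u v w (p c)) (hd : 0 ≤ aff u v w (p d)) : Ok p a b c d := by
  rintro x ⟨hx1, hx2⟩
  obtain ⟨α, β, h1, h2, h3, h4, h5⟩ := aff_comb u v w _ _ _ hx1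
  obtain ⟨α', β', h1', h2', h3', h4', h5'⟩ := aff_comb u v w _ _ _ hx2
  exfalso
  have hp : 0 ≤ aff u v w x := by rw [h5']; positivity
  have hn : aff u v w x < 0 := by
    rw [h5]
    rcases h1.eq_or_lt with h | h
    · have : β = 1 := by linarith
      subst this; subst h; linarith
    · nlinarith
  linarith

/-- Separation with a common vertex. -/
lemma ok_touch {V : Type*} {p : V → ℝ × ℝ} {a b c d : V} (u v w : ℝ)
    (ha : aff u v w (p a) = 0) (hb : aff u v w (p b) < 0)
    (hc : 0 ≤ aff u v w (p c)) (hd : 0 ≤ aff u v w (p d)) (hac : a = c ∨ a = d) :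
    Ok p a b c d := by
  rintro x ⟨hx1, hx2⟩
  obtain ⟨α, β, h1, h2, h3, h4, h5⟩ := aff_comb u v w _ _ _ hx1
  obtain ⟨α', β', h1', h2', h3', h4', h5'⟩ := aff_comb u v w _ _ _ hx2
  have hp : 0 ≤ aff u v w x := by rw [h5']; positivity
  have hβ : β = 0 := by
    rcases h2.eq_or_lt with h | h
    · exact h.symm
    · exfalso
      have := mul_neg_of_pos_of_neg h hb
      rw [h5, ha] at hp
      linarith
  have hα : α = 1 := by linarith
  subst hα; subst hβ
  refine ⟨a, ⟨by simp, by simpa using hac⟩, ?_⟩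
  rw [← h4]; simp

lemma aff_neg (u v w : ℝ) (x : ℝ × ℝ) : aff (-u) (-v) (-w) x = - aff u v w x := by
  unfold aff; ring

/-- Line through the second segment, the first one leaves it. -/
lemma ok_line {V : Type*} {p : V → ℝ × ℝ} {a b c d : V} (u v w : ℝ)
    (ha : aff u v w (p a) = 0) (hb : aff u v w (p b) ≠ 0)
    (hc : 0 = aff u v w (p c)) (hd : 0 = aff u v w (p d)) (hac : a = c ∨ a = d) :
    Ok p a b c d := by
  rcases lt_or_gt_of_ne hb with h | h
  · exact ok_touch u v w ha h hc.le hd.le hac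
  · apply ok_touch (-u) (-v) (-w) _ _ _ _ hac <;> rw [aff_neg] <;> linarith

/-- The points: `s` is the inverse slope, `t` the height. -/
def pt {V : Type*} (N : ℝ) (σ tr : V → ℕ) (v : V) : ℝ × ℝ :=
  (N ^ σ v * (tr v : ℝ), (tr v : ℝ))

lemma dominate (n s1 s2 s3 : ℝ) (t1 t2 t3 : ℝ) (hn : 0 ≤ n) (h1 : 0 < s1) (h12 : s1 ≤ s2)
    (h23 : (2 * n ^ 2 + 1) * s2 ≤ s3) (h3 : 1 ≤ t3)
    (ht1 : 0 ≤ t1) (ht2 : 0 ≤ t2)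
    (ht1n : t1 ≤ n) (ht2n : t2 ≤ n) (ht3n : t3 ≤ n) (hd : 1 ≤ |t1 - t2|) :
    s1 * t1 * (t2 - t3) + s2 * t2 * (t3 - t1) + s3 * t3 * (t1 - t2) ≠ 0 := by
  intro h
  have e1 : |s1 * t1 * (t2 - t3)| ≤ s2 * n * n := by
    rw [abs_mul, abs_of_nonneg (by positivity : 0 ≤ s1 * t1)]
    have : |t2 - t3| ≤ n := by rw [abs_le]; constructor <;> linarith
    have h2 : 0 ≤ s2 := by linarith
    gcongr
  have e2 : |s2 * t2 * (t3 - t1)| ≤ s2 * n * n := by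
    have h2 : 0 ≤ s2 := by linarith
    rw [abs_mul, abs_of_nonneg (by positivity : 0 ≤ s2 * t2)]
    have : |t3 - t1| ≤ n := by rw [abs_le]; constructor <;> linarith
    gcongr
  have e3 : (2 * n ^ 2 + 1) * s2 ≤ |s3 * t3 * (t1 - t2)| := by
    have h2 : 0 < s2 := by linarith
    have hs3 : 0 ≤ s3 := le_trans (by positivity) h23
    rw [abs_mul, abs_of_nonneg (by positivity : 0 ≤ s3 * t3)]
    calc (2 * n ^ 2 + 1) * s2 ≤ s3 := h23
      _ = s3 * 1 * 1 := by ring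
      _ ≤ _ := by gcongr
  have e4 : s3 * t3 * (t1 - t2) = -(s1 * t1 * (t2 - t3) + s2 * t2 * (t3 - t1)) := by linarith
  rw [e4, abs_neg] at e3
  have e5 := abs_add_le (s1 * t1 * (t2 - t3)) (s2 * t2 * (t3 - t1))
  have h2 : 0 < s2 := by linarith
  nlinarith

lemma abs_nat_sub (a b : ℕ) (h : a ≠ b) : (1 : ℝ) ≤ |(a : ℝ) - b| := by
  have : (1 : ℤ) ≤ |(a : ℤ) - b| := Int.one_le_abs (by omega)
  exact_mod_cast this

lemma general_aux {V : Type*} (n : ℕ) (σ tr : V → ℕ) (hn : ∀ v, tr v ≤ n) (a b c : V)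
    (hab : σ a < σ b) (hbc : σ b < σ c) (t3 : 1 ≤ tr c) (htab : tr a ≠ tr b) :
    (2 * (n : ℝ) ^ 2 + 1) ^ σ a * tr a * (tr b - tr c) +
    (2 * (n : ℝ) ^ 2 + 1) ^ σ b * tr b * (tr c - tr a) +
    (2 * (n : ℝ) ^ 2 + 1) ^ σ c * tr c * (tr a - tr b) ≠ 0 := by
  have hN : (1 : ℝ) ≤ 2 * (n : ℝ) ^ 2 + 1 := by nlinarith [sq_nonneg (n : ℝ)]
  apply dominate (n : ℝ)
  · positivity
  · positivity
  · exact pow_le_pow_right₀ hN hab.le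
  · rw [← pow_succ']; exact pow_le_pow_right₀ hN hbc
  · exact_mod_cast t3
  · positivity
  · positivity
  · exact_mod_cast hn a
  · exact_mod_cast hn b
  · exact_mod_cast hn c
  · exact abs_nat_sub _ _ htab

lemma general {V : Type*} (n : ℕ) (σ tr : V → ℕ) (hn : ∀ v, tr v ≤ n) (a b c : V)
    (hab : σ a ≠ σ b) (hbc : σ b ≠ σ c) (hac : σ a ≠ σ c)
    (t1 : 1 ≤ tr a) (t2 : 1 ≤ tr b) (t3 : 1 ≤ tr c)
    (htab : tr a ≠ tr b) (htbc : tr b ≠ tr c) (htac : tr a ≠ tr c) :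
    (2 * (n : ℝ) ^ 2 + 1) ^ σ a * tr a * (tr b - tr c) +
    (2 * (n : ℝ) ^ 2 + 1) ^ σ b * tr b * (tr c - tr a) +
    (2 * (n : ℝ) ^ 2 + 1) ^ σ c * tr c * (tr a - tr b) ≠ 0 := by
  intro h
  rcases lt_or_gt_of_ne hab with h1 | h1 <;> rcases lt_or_gt_of_ne hbc with h2 | h2 <;>
    rcases lt_or_gt_of_ne hac with h3 | h3
  · exact general_aux n σ tr hn a b c h1 h2 t3 htab h
  · omega
  · exact general_aux n σ tr hn a c b h3 h2 t2 htac (by linarith)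
  · exact general_aux n σ tr hn c a b h3 h1 t2 htac.symm (by linarith)
  · exact general_aux n σ tr hn b a c h1 h3 t3 htab.symm (by linarith)
  · exact general_aux n σ tr hn b c a h2 h3 t1 htbc (by linarith)
  · omega
  · exact general_aux n σ tr hn c b a h2 h1 t1 htbc.symm (by linarith)

/-- Oriented tree edge. -/
def E {V : Type*} (r : V) (par : V → V) (a b : V) : Prop :=
  (a = r ∧ b ≠ r ∧ par b = b) ∨ (a ≠ r ∧ b ≠ r ∧ par a = a ∧ par b = a ∧ a ≠ b)

section geo
variable {V : Type*} (r : V) (par : V → V) (n : ℕ) (σ tr g : V → ℕ)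

/-- Side functional of the line through the root and `c`. -/
lemma side (N : ℝ) (c v : V) :
    aff 1 (-N ^ σ c) 0 (pt N σ tr v) = (N ^ σ v - N ^ σ c) * tr v := by
  unfold aff pt; ring

lemma tree_ok (hn : ∀ v, tr v ≤ n) (htr : Function.Injective tr) (hr : tr r = 0)
    (hσ : ∀ v w, v ≠ r → w ≠ r → σ v = σ w → v = w)
    (hg : ∀ v w, v ≠ r → w ≠ r → (g v = g w ↔ par v = par w))
    (hgσ : ∀ v w, v ≠ r → w ≠ r → g v < g w → σ v < σ w)
    (hn1 : 1 ≤ n)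
    (a b c d : V) (h1 : E r par a b) (h2 : E r par c d) (hne : s(a, b) ≠ s(c, d)) :
    Ok (pt (2 * (n : ℝ) ^ 2 + 1) σ tr) a b c d := by
  set N : ℝ := 2 * (n : ℝ) ^ 2 + 1 with hNdef
  have hN : (1 : ℝ) < N := by
    have : (1 : ℝ) ≤ n := by exact_mod_cast hn1
    nlinarith
  have tpos : ∀ v, v ≠ r → 1 ≤ tr v := by
    intro v hv
    by_contra h
    exact hv (htr (by omega))
  have tposR : ∀ v, v ≠ r → (0 : ℝ) < tr v := by
    intro v hv; exact_mod_cast tpos v hv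
  have sroot : ∀ c, aff 1 (-N ^ σ c) 0 (pt N σ tr r) = 0 := by
    intro c; rw [side, hr]; simp
  have sself : ∀ c, aff 1 (-N ^ σ c) 0 (pt N σ tr c) = 0 := by
    intro c; rw [side]; simp
  have slt : ∀ c v, v ≠ r → σ v < σ c → aff 1 (-N ^ σ c) 0 (pt N σ tr v) < 0 := by
    intro c v hv h
    rw [side]
    have := pow_lt_pow_right₀ hN h
    exact mul_neg_of_neg_of_pos (by linarith) (tposR v hv)
  have sgt : ∀ c v, v ≠ r → σ c < σ v → 0 < aff 1 (-N ^ σ c) 0 (pt N σ tr v) := by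
    intro c v hv h
    rw [side]
    have := pow_lt_pow_right₀ hN h
    exact mul_pos (by linarith) (tposR v hv)
  have sne : ∀ c v, v ≠ r → c ≠ r → v ≠ c → aff 1 (-N ^ σ c) 0 (pt N σ tr v) ≠ 0 := by
    intro c v hv hc h
    rcases lt_or_gt_of_ne (fun e => h (hσ v c hv hc e)) with h' | h'
    · exact (slt c v hv h').ne
    · exact (sgt c v hv h').ne'
  have mixed : ∀ b c d, b ≠ r → par b = b → c ≠ r → d ≠ r → par c = c → par d = c → c ≠ d →
      Ok (pt N σ tr) r b c d := by
    intro b c d hb pb hc hd pc pd hcd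
    by_cases hbc : c = b
    · subst hbc
      refine Ok.swap (ok_line 1 (-N ^ σ c) 0 (sself c) (sne c d hd hc hcd.symm) (sroot c).symm
        (sself c).symm (Or.inr rfl))
    · have h1 : g b ≠ g c := fun e => hbc (by
        have := (hg b c hb hc).1 e; rw [pb, pc] at this; exact this.symm)
      have h2 : g c = g d := (hg c d hc hd).2 (by rw [pc, pd])
      rcases lt_or_gt_of_ne h1 with h | h
      · apply Ok.swap
        apply ok_sep (-1) (-(-N ^ σ b)) (-0) <;> rw [aff_neg]
        · linarith [sgt b c hc (hgσ b c hb hc h)]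
        · linarith [sgt b d hd (hgσ b d hb hd (h2 ▸ h))]
        · linarith [sroot b]
        · linarith [sself b]
      · exact Ok.swap (ok_sep 1 (-N ^ σ b) 0 (slt b c hc (hgσ c b hc hb h))
          (slt b d hd (hgσ d b hd hb (h2 ▸ h))) (sroot b).ge (sself b).ge)
  have groups : ∀ a b c d, a ≠ r → b ≠ r → c ≠ r → d ≠ r → g a = g b → g c = g d → g a < g c →
      Ok (pt N σ tr) a b c d := by
    intro a b c d ha hb hc hd hab hcd hac
    have hle : ∀ e v, v ≠ r → σ v ≤ σ e → aff 1 (-N ^ σ e) 0 (pt N σ tr v) ≤ 0 := by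
      intro e v hv h
      rw [side]
      have := pow_le_pow_right₀ hN.le h
      exact mul_nonpos_of_nonpos_of_nonneg (by linarith) (tposR v hv).le
    have key : ∀ e, e ≠ r → g e = g a → σ a ≤ σ e → σ b ≤ σ e → Ok (pt N σ tr) a b c d := by
      intro e he hge h1 h2
      apply Ok.swap
      apply ok_sep (-1) (-(-N ^ σ e)) (-0) <;> rw [aff_neg]
      · linarith [sgt e c hc (hgσ e c he hc (by omega))]
      · linarith [sgt e d hd (hgσ e d he hd (by omega))]
      · linarith [hle e a ha h1]
      · linarith [hle e b hb h2]
    rcases le_total (σ a) (σ b) with h | h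
    · exact key b hb hab.symm h le_rfl
    · exact key a ha rfl le_rfl h
  rcases h1 with ⟨rfl, hb, pb⟩ | ⟨ha, hb, pa, pb, hab⟩
  · rcases h2 with ⟨rfl, hd, pd⟩ | ⟨hc, hd, pc, pd, hcd⟩
    · have hbd : b ≠ d := by rintro rfl; exact hne rfl
      exact ok_line 1 (-N ^ σ d) 0 (sroot d) (sne d b hb hd hbd) (sroot d).symm (sself d).symm
        (Or.inl rfl)
    · exact mixed b c d hb pb hc hd pc pd hcd
  · rcases h2 with ⟨rfl, hd, pd⟩ | ⟨hc, hd, pc, pd, hcd⟩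
    · exact (mixed d a b hd pd ha hb pa pb hab).swap
    · by_cases hac : a = c
      · subst hac
        have hbd : b ≠ d := by rintro rfl; exact hne rfl
        have gen := general n σ tr hn a b d (fun e => hab (hσ _ _ ha hb e))
          (fun e => hbd (hσ _ _ hb hd e)) (fun e => hcd (hσ _ _ ha hd e))
          (tpos a ha) (tpos b hb) (tpos d hd) (fun e => hab (htr e)) (fun e => hbd (htr e))
          (fun e => hcd (htr e))
        rw [← hNdef] at gen
        apply ok_line ((tr d : ℝ) - tr a) (-(N ^ σ d * tr d - N ^ σ a * tr a))
          (-(N ^ σ a * tr a * ((tr d : ℝ) - tr a)) + tr a * (N ^ σ d * tr d - N ^ σ a * tr a))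
        · unfold aff pt; ring
        · intro h
          apply gen
          rw [← h]
          unfold aff pt; ring
        · unfold aff pt; ring
        · unfold aff pt; ring
        · exact Or.inl rfl
      · have hgac : g a ≠ g c := fun e => hac (by
          have := (hg a c ha hc).1 e; rwa [pa, pc] at this)
        have hgab : g a = g b := (hg a b ha hb).2 (by rw [pa, pb])
        have hgcd : g c = g d := (hg c d hc hd).2 (by rw [pc, pd])
        rcases lt_or_gt_of_ne hgac with h | h
        · exact groups a b c d ha hb hc hd hgab hgcd h
        · exact (groups c d a b hc hd ha hb hgcd hgab h).swap

/-- Path edges: consecutive heights, or the special edge from the root to `b`. -/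
lemma path_ok (hn1 : 1 ≤ n) (htr : Function.Injective tr) (hr : tr r = 0)
    (F : V → V → Prop)
    (hF : ∀ a b, F a b → tr b = tr a + 1 ∨ (a = r ∧ b ≠ r ∧ (∀ v, v ≠ r → v ≠ b → σ b < σ v) ∧
      ∀ c d, F c d → tr d = tr c + 1 → tr c ≠ 0 → tr c < tr b → tr d < tr b))
    (a b c d : V) (h1 : F a b) (h2 : F c d) (hne : s(a, b) ≠ s(c, d)) :
    Ok (pt (2 * (n : ℝ) ^ 2 + 1) σ tr) a b c d := by
  set N : ℝ := 2 * (n : ℝ) ^ 2 + 1 with hNdef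
  have hN : (1 : ℝ) < N := by
    have : (1 : ℝ) ≤ n := by exact_mod_cast hn1
    nlinarith
  have hgt : ∀ m : ℕ, ∀ v, aff 0 1 (-(m : ℝ)) (pt N σ tr v) = tr v - m := by
    intro m v; unfold aff pt; ring
  have cons : ∀ a b c d, tr a < tr b → tr c < tr d → tr b ≤ tr c → Ok (pt N σ tr) a b c d := by
    intro a b c d hab hcd h
    have hab' : (tr a : ℝ) < tr b := by exact_mod_cast hab
    have hcd' : (tr c : ℝ) < tr d := by exact_mod_cast hcd
    rcases h.eq_or_lt with h | h
    · have hbc := htr h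
      subst hbc
      apply Ok.swapl
      apply ok_touch 0 1 (-(tr b : ℝ)) _ _ _ _ (Or.inl rfl) <;> rw [hgt] <;> linarith
    · have h' : (tr b : ℝ) < tr c := by exact_mod_cast h
      apply ok_sep 0 1 (-(tr c : ℝ)) <;> rw [hgt] <;> linarith
  have spec : ∀ b c d, b ≠ r → (∀ v, v ≠ r → v ≠ b → σ b < σ v) → tr d = tr c + 1 →
      (tr c ≠ 0 → tr c < tr b → tr d < tr b) → s(r, b) ≠ s(c, d) → Ok (pt N σ tr) r b c d := by
    intro b c d hb hv hcd hlt hne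
    have hb0 : tr b ≠ 0 := fun e => hb (htr (by rw [e, hr]))
    have pos : ∀ v, v ≠ r → v ≠ b → aff (-1) (-(-N ^ σ b)) (-0) (pt N σ tr v) < 0 := by
      intro v h h'
      rw [aff_neg, side]
      have h1 := pow_lt_pow_right₀ hN (hv v h h')
      have h2 : (0 : ℝ) < tr v := by
        have : tr v ≠ 0 := fun e => h (htr (by rw [e, hr]))
        positivity
      have := mul_pos (by linarith : 0 < N ^ σ v - N ^ σ b) h2
      linarith
    have z1 : aff (-1) (-(-N ^ σ b)) (-0) (pt N σ tr r) = 0 := by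
      rw [aff_neg, side, hr]; simp
    have z2 : aff (-1) (-(-N ^ σ b)) (-0) (pt N σ tr b) = 0 := by
      rw [aff_neg, side]; simp
    have hdr : d ≠ r := by rintro rfl; omega
    by_cases hcb : tr b ≤ tr c
    · exact cons r b c d (by omega) (by omega) hcb
    · push Not at hcb
      have hcb' : c ≠ b := by rintro rfl; omega
      apply Ok.swap
      by_cases hc : c = r
      · subst hc
        have hdb : d ≠ b := by rintro rfl; exact hne rfl
        exact ok_touch (-1) (-(-N ^ σ b)) (-0) z1 (pos d hdr hdb) z1.ge z2.ge (Or.inl rfl)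
      · have hdb := hlt (fun e => hc (htr (by rw [e, hr]))) hcb
        have hdb' : d ≠ b := by rintro rfl; omega
        exact ok_sep (-1) (-(-N ^ σ b)) (-0) (pos c hc hcb') (pos d hdr hdb') z1.ge z2.ge
  rcases hF a b h1 with h | ⟨rfl, hb, hσb, hlt⟩
  · rcases hF c d h2 with h' | ⟨rfl, hb, hσb, hlt⟩
    · rcases lt_trichotomy (tr a) (tr c) with h3 | h3 | h3
      · exact cons a b c d (by omega) (by omega) (by omega)
      · exact absurd (by rw [htr h3, htr (by omega : tr b = tr d)]) hne
      · exact (cons c d a b (by omega) (by omega) (by omega)).swap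
    · exact (spec d a b hb hσb h (hlt a b h1 h) hne.symm).swap
  · rcases hF c d h2 with h' | ⟨rfl, hb', hσb', hlt'⟩
    · exact spec b c d hb hσb h' (hlt c d h2 h') hne
    · by_cases hbd : b = d
      · exact absurd (by rw [hbd]) hne
      · have := hσb d hb' (Ne.symm hbd)
        have := hσb' b hb hbd
        omega

lemma pt_inj (N : ℝ) (htr : Function.Injective tr) : Function.Injective (pt N σ tr) := by
  intro a b h
  have : (tr a : ℝ) = tr b := congrArg Prod.snd h
  exact htr (by exact_mod_cast this)

end geo

lemma path_of_two {V : Type*} {T : SimpleGraph V} {a b c : V} (h1 : T.Adj a b) (h2 : T.Adj b c)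
    (hac : a ≠ c) : (SimpleGraph.Walk.cons h1 (SimpleGraph.Walk.cons h2 .nil)).IsPath := by
  simp [SimpleGraph.Walk.cons_isPath_iff, h1.ne, h2.ne, hac]

/-- Structure of a tree of depth two. -/
lemma tree_struct {V : Type*} (T : SimpleGraph V) (hT : T.IsTree) (r : V)
    (hr : ∀ w, T.dist r w ≤ 2) :
    ∃ par : V → V, ∀ a b, T.Adj a b → E r par a b ∨ E r par b a := by
  classical
  have hex : ∀ v, v ≠ r → ¬ T.Adj v r → ∃ c, T.Adj v c ∧ T.Adj c r := by
    intro v hv hadj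
    obtain ⟨w, hw⟩ := (hT.connected v r).exists_walk_length_eq_dist
    have h2 := hr v
    rw [SimpleGraph.dist_comm, ← hw] at h2
    cases w with
    | nil => exact absurd rfl hv
    | cons h p =>
      cases p with
      | nil => exact absurd h hadj
      | cons h' p' =>
        cases p' with
        | nil => exact ⟨_, h, h'⟩
        | cons _ _ => simp at h2
  have uniq : ∀ {a b : V} (p q : T.Walk a b), p.IsPath → q.IsPath → p = q := by
    intro a b p q hp hq
    have := (hT.isAcyclic.subsingleton_path a b).elim ⟨p, hp⟩ ⟨q, hq⟩
    exact congrArg Subtype.val this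
  choose f hf1 hf2 using hex
  let par : V → V := fun v => if hv : v ≠ r then (if h : T.Adj v r then v else f v hv h) else r
  have par1 : ∀ v, T.Adj v r → par v = v := by
    intro v h; simp [par, h, h.ne]
  have par2 : ∀ v (hv : v ≠ r) (h : ¬ T.Adj v r), T.Adj v (par v) ∧ T.Adj (par v) r := by
    intro v hv h
    have : par v = f v hv h := by simp [par, h, hv]
    rw [this]; exact ⟨hf1 v hv h, hf2 v hv h⟩
  have key : ∀ a b, T.Adj a b → a ≠ r → b ≠ r → T.Adj a r → E r par a b := by
    intro a b hab ha hb har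
    by_cases hbr : T.Adj b r
    · exfalso
      have := uniq _ _ (path_of_two hab hbr ha) (by simp [har.ne] : (har.toWalk).IsPath)
      have := congrArg SimpleGraph.Walk.length this
      simp at this
    · obtain ⟨h1, h2⟩ := par2 b hb hbr
      refine Or.inr ⟨ha, hb, par1 a har, ?_, hab.ne⟩
      have := uniq _ _ (path_of_two h1 h2 hb) (path_of_two hab.symm har hb)
      have := congrArg SimpleGraph.Walk.support this
      simpa using this
  refine ⟨par, fun a b hab => ?_⟩
  by_cases ha : a = r
  · subst ha; exact Or.inl (Or.inl ⟨rfl, hab.ne.symm, par1 b hab.symm⟩)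
  by_cases hb : b = r
  · subst hb; exact Or.inr (Or.inl ⟨rfl, hab.ne, par1 a hab⟩)
  by_cases har : T.Adj a r
  · exact Or.inl (key a b hab ha hb har)
  by_cases hbr : T.Adj b r
  · exact Or.inr (key b a hab.symm hb ha hbr)
  exfalso
  obtain ⟨h1, h2⟩ := par2 a ha har
  obtain ⟨h3, h4⟩ := par2 b hb hbr
  have hne : a ≠ par b := by intro e; rw [← e] at h4; exact har h4
  have := uniq _ (SimpleGraph.Walk.cons hab (.cons h3 (.cons h4 .nil)))
    (path_of_two h1 h2 ha) (by
      simp [SimpleGraph.Walk.cons_isPath_iff, hab.ne, h3.ne, h4.ne, hne, ha, hb])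
  have := congrArg SimpleGraph.Walk.length this
  simp at this

end GSE

/-- A tree of depth 2 and a path on the same finite vertex set always admit a geometric
simultaneous embedding. -/
theorem depth_two_tree_and_path_geometric_simultaneous_embedding
    (V : Type) [Fintype V] (T P : SimpleGraph V)
    (hT : T.IsTree) (hdepth : ∃ r : V, ∀ w : V, T.dist r w ≤ 2)
    (hP : IsPathGraph P) :
    ∃ p : V → ℝ × ℝ, IsPlanarDrawing T p ∧ IsPlanarDrawing P p := by
  classical
  obtain ⟨r, hr⟩ := hdepth
  obtain ⟨par, hpar⟩ := GSE.tree_struct T hT r hr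
  obtain ⟨e, he⟩ := hP
  obtain ⟨n, hn⟩ : ∃ n, n = Fintype.card V := ⟨_, rfl⟩
  have hn1 : 1 ≤ n := hn ▸ Fintype.card_pos_iff.2 ⟨r⟩
  obtain ⟨idx, hidx⟩ : ∃ idx : V → ℕ, idx = fun v => ((e.symm v : Fin (Fintype.card V)) : ℕ) := ⟨_, rfl⟩
  have ilt : ∀ v, idx v < n := by intro v; rw [hidx, hn]; exact (e.symm v).2
  have iinj : ∀ v w, idx v = idx w → v = w := by
    intro v w h
    rw [hidx] at h
    exact e.symm.injective (Fin.ext h)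
  have hadj : ∀ a b, P.Adj a b ↔ (idx a + 1 = idx b ∨ idx b + 1 = idx a) := by
    rw [hidx]; exact he
  obtain ⟨tr, htr⟩ : ∃ tr : V → ℕ, tr = fun v =>
    if idx v < idx r then idx r - idx v else if idx v = idx r then 0 else idx v := ⟨_, rfl⟩
  obtain ⟨g, hg⟩ : ∃ g : V → ℕ, g = fun v =>
    if ∃ w, idx w = idx r + 1 ∧ par w = par v then 0 else idx (par v) + 1 := ⟨_, rfl⟩
  obtain ⟨σ, hσ⟩ : ∃ σ : V → ℕ, σ = fun v =>
    g v * (n + 1) + if idx v = idx r + 1 then 0 else idx v + 1 := ⟨_, rfl⟩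
  have tr_inj : Function.Injective tr := by
    intro v w h
    apply iinj
    rw [htr] at h
    dsimp only at h
    split_ifs at h <;> omega
  have tr_r : tr r = 0 := by rw [htr]; simp
  have tr_n : ∀ v, tr v ≤ n := by
    intro v
    have := ilt v
    have := ilt r
    rw [htr]; dsimp only
    split_ifs <;> omega
  have hgpar : ∀ v w, g v = g w ↔ par v = par w := by
    intro v w
    constructor
    · intro h
      rw [hg] at h
      dsimp only at h
      by_cases h1 : ∃ w, idx w = idx r + 1 ∧ par w = par v <;>
        by_cases h2 : ∃ x, idx x = idx r + 1 ∧ par x = par w <;>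
        simp only [h1, h2, if_true, if_false] at h
      · obtain ⟨x, hx, hx'⟩ := h1
        obtain ⟨y, hy, hy'⟩ := h2
        have := iinj x y (by omega)
        rw [← hx', ← hy', this]
      · omega
      · omega
      · exact iinj _ _ (by omega)
    · intro h; rw [hg]; dsimp only; rw [h]
  have loc : ∀ v, (if idx v = idx r + 1 then 0 else idx v + 1) ≤ n := by
    intro v; have := ilt v; split_ifs <;> omega
  have gσ : ∀ v w, g v < g w → σ v < σ w := by
    intro v w h
    rw [hσ]; dsimp only
    have h1 := loc v
    have h2 : (g v + 1) * (n + 1) ≤ g w * (n + 1) := Nat.mul_le_mul_right _ h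
    rw [Nat.add_mul] at h2
    omega
  have σinj : ∀ v w, σ v = σ w → v = w := by
    intro v w h
    have hgg : g v = g w := by
      rcases lt_trichotomy (g v) (g w) with h' | h' | h'
      · have := gσ _ _ h'; omega
      · exact h'
      · have := gσ _ _ h'; omega
    rw [hσ] at h; dsimp only at h
    rw [hgg] at h
    apply iinj
    split_ifs at h <;> omega
  have bmin : ∀ b, idx b = idx r + 1 → ∀ v, v ≠ b → σ b < σ v := by
    intro b hb v hv
    have hgb : g b = 0 := by
      rw [hg]; dsimp only; rw [if_pos ⟨b, hb, rfl⟩]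
    have : σ b = 0 := by rw [hσ]; dsimp only; rw [hgb, if_pos hb]; simp
    have : σ v ≠ σ b := fun h => hv (σinj _ _ h)
    omega
  refine ⟨GSE.pt (2 * (n : ℝ) ^ 2 + 1) σ tr, ⟨GSE.pt_inj σ tr _ tr_inj, ?_⟩,
    ⟨GSE.pt_inj σ tr _ tr_inj, ?_⟩⟩
  · intro a b c d hab hcd hne
    have main : ∀ a b c d, GSE.E r par a b → GSE.E r par c d → s(a, b) ≠ s(c, d) → _ :=
      GSE.tree_ok r par n σ tr g tr_n tr_inj tr_r (fun v w _ _ h => σinj v w h)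
        (fun v w _ _ => hgpar v w) (fun v w _ _ h => gσ v w h) hn1
    rcases hpar a b hab with h1 | h1 <;> rcases hpar c d hcd with h2 | h2
    · exact main a b c d h1 h2 hne
    · exact (main a b d c h1 h2 (by rwa [Sym2.eq_swap (a := d)])).swapr
    · exact (main b a c d h1 h2 (by rwa [Sym2.eq_swap (a := b)])).swapl
    · exact (main b a d c h1 h2 (by rwa [Sym2.eq_swap (a := b), Sym2.eq_swap (a := d)])).swapl.swapr
  · intro a b c d hab hcd hne
    let F : V → V → Prop := fun a b => P.Adj a b ∧ tr a < tr b
    have main := GSE.path_ok r n σ tr hn1 tr_inj tr_r F (by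
      rintro a b ⟨hab, hlt⟩
      have cases1 : ∀ v, (idx v < idx r ∧ tr v = idx r - idx v) ∨ (idx v = idx r ∧ tr v = 0) ∨
          (idx r < idx v ∧ tr v = idx v) := by
        intro v
        rw [htr]; dsimp only
        split_ifs <;> omega
      by_cases hc : tr b = tr a + 1
      · exact Or.inl hc
      right
      rw [hadj] at hab
      have ca := cases1 a
      have cb := cases1 b
      have har : idx a = idx r := by omega
      have hbr : idx b = idx r + 1 := by omega
      refine ⟨iinj _ _ har, by rintro rfl; omega, fun v _ hv => bmin b hbr v hv, ?_⟩
      rintro c d ⟨hcd, _⟩ h1 h2 h3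
      rw [hadj] at hcd
      have cc := cases1 c
      have cd := cases1 d
      omega)
    have orient : ∀ a b, P.Adj a b → F a b ∨ F b a := by
      intro a b h
      rcases lt_trichotomy (tr a) (tr b) with h' | h' | h'
      · exact Or.inl ⟨h, h'⟩
      · exact absurd (tr_inj h') h.ne
      · exact Or.inr ⟨h.symm, h'⟩
    rcases orient a b hab with h1 | h1 <;> rcases orient c d hcd with h2 | h2
    · exact main a b c d h1 h2 hne
    · exact (main a b d c h1 h2 (by rwa [Sym2.eq_swap (a := d)])).swapr
    · exact (main b a c d h1 h2 (by rwa [Sym2.eq_swap (a := b)])).swapl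
    · exact (main b a d c h1 h2 (by rwa [Sym2.eq_swap (a := b), Sym2.eq_swap (a := d)])).swapl.swapr
end

section
/- Let T₀ be the tree on the ten vertices v₁,…,v₁₀ with edge set {v₁v₂, v₁v₃, v₁v₄, v₂v₅, v₂v₈, v₃v₆, v₃v₉, v₄v₇, v₄v₁₀} (a root v₁ with three children v₂, v₃, v₄, each of which has exactly two leaf children). Then there exists a leveling φ : {v₁,…,v₁₀} → {1,2,3,4} with φ(u) ≠ φ(w) for every edge uw of T₀, such that T₀ is region-level nonplanar for this leveling: for every nonzero linear functional f : ℝ² → ℝ and all real numbers c₁ < c₂ < c₃, defining the four open regions S₁ = {x ∈ ℝ² : f(x) < c₁}, S₂ = {x : c₁ < f(x) < c₂}, S₃ = {x : c₂ < f(x) < c₃}, S₄ = {x : c₃ < f(x)}, there is no injective map p : {v₁,…,v₁₀} → ℝ² with p(vⱼ) ∈ S_{φ(vⱼ)} for every j that is a planar straight-line drawing of T₀. -/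
/-- The ten-vertex tree `T₀`: vertex `0` (i.e. `v₁`) is the root with children `1`, `2`, `3`
(i.e. `v₂`, `v₃`, `v₄`), each of which has exactly two leaf children. Vertex `j : Fin 10`
stands for `v_{j+1}`. -/
def T₀ : SimpleGraph (Fin 10) :=
  SimpleGraph.fromEdgeSet
    {s(0, 1), s(0, 2), s(0, 3), s(1, 4), s(1, 7), s(2, 5), s(2, 8), s(3, 6), s(3, 9)}

/-- The four open regions determined by the three parallel lines `f = c₁`, `f = c₂`,
`f = c₃` (with `c₁ < c₂ < c₃`), in order. -/
def levelRegion (f : (ℝ × ℝ) →ₗ[ℝ] ℝ) (c₁ c₂ c₃ : ℝ) : Fin 4 → Set (ℝ × ℝ)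
  | 0 => {x | f x < c₁}
  | 1 => {x | c₁ < f x ∧ f x < c₂}
  | 2 => {x | c₂ < f x ∧ f x < c₃}
  | 3 => {x | c₃ < f x}

lemma seg_curve (f : (ℝ × ℝ) →ₗ[ℝ] ℝ) (A B : ℝ × ℝ) (h : f A < f B) :
    ∃ γ : ℝ → ℝ × ℝ, Continuous γ ∧ (∀ t, f (γ t) = t) ∧ γ (f A) = A ∧ γ (f B) = B ∧
      ∀ t, f A ≤ t → t ≤ f B → γ t ∈ segment ℝ A B := by
  have hpos : 0 < f B - f A := sub_pos.2 h
  refine ⟨fun t => A + ((t - f A) / (f B - f A)) • (B - A), by fun_prop, ?_, ?_, ?_, ?_⟩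
  · intro t
    simp only [map_add, map_smul, map_sub, smul_eq_mul]
    field_simp
    ring
  · simp
  · simp [div_self hpos.ne']
  · intro t h1 h2
    rw [segment_eq_image']
    refine ⟨(t - f A) / (f B - f A), ⟨div_nonneg (by linarith) hpos.le, ?_⟩, rfl⟩
    rw [div_le_one hpos]
    linarith

lemma path_curve (f : (ℝ × ℝ) →ₗ[ℝ] ℝ) (A C B : ℝ × ℝ) (h : f A < f C) (h' : f C < f B) :
    ∃ γ : ℝ → ℝ × ℝ, Continuous γ ∧ (∀ t, f (γ t) = t) ∧ γ (f C) = C ∧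
      ∀ t, f A ≤ t → t ≤ f B → γ t ∈ segment ℝ C A ∨ γ t ∈ segment ℝ C B := by
  obtain ⟨γ, c, e, -, eC, s⟩ := seg_curve f A C h
  obtain ⟨δ, c', e', eC', -, s'⟩ := seg_curve f C B h'
  refine ⟨fun t => if t ≤ f C then γ t else δ t, ?_, ?_, ?_, ?_⟩
  · refine Continuous.if_le c c' continuous_id continuous_const ?_
    intro x hx
    have hx' : x = f C := hx
    rw [hx', eC, eC']
  · intro t
    dsimp only
    split_ifs
    · exact e t
    · exact e' t
  · simp [eC]
  · intro t h1 h2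
    dsimp only
    split_ifs with h3
    · left
      rw [segment_symm]
      exact s t h1 h3
    · right
      exact s' t (not_le.1 h3).le h2

lemma same_side (u v : ℝ → ℝ) (hu : Continuous u) (hv : Continuous v) (a b x y : ℝ)
    (hx : x ∈ Set.Icc a b) (hy : y ∈ Set.Icc a b)
    (h : ∀ t ∈ Set.Icc a b, u t ≠ v t) (hlt : u x < v x) : u y < v y := by
  by_contra hc
  obtain ⟨t, ht, e⟩ := isPreconnected_Icc.intermediate_value₂ hx hy hu.continuousOn
    hv.continuousOn hlt.le (not_lt.1 hc)
  exact h t ht e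

lemma same_side_iff (u v : ℝ → ℝ) (hu : Continuous u) (hv : Continuous v) (a b x y : ℝ)
    (hx : x ∈ Set.Icc a b) (hy : y ∈ Set.Icc a b)
    (h : ∀ t ∈ Set.Icc a b, u t ≠ v t) : u x < v x ↔ u y < v y :=
  ⟨same_side u v hu hv a b x y hx hy h, same_side u v hu hv a b y x hy hx h⟩

lemma exists_coord (f : (ℝ × ℝ) →ₗ[ℝ] ℝ) (hf : f ≠ 0) :
    ∃ g : ℝ × ℝ → ℝ, Continuous g ∧ ∀ x y, f x = f y → g x = g y → x = y := by
  have hx : ∀ x : ℝ × ℝ, f x = x.1 * f (1, 0) + x.2 * f (0, 1) := by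
    intro x
    have : x = x.1 • ((1, 0) : ℝ × ℝ) + x.2 • ((0, 1) : ℝ × ℝ) := by ext <;> simp
    conv_lhs => rw [this]
    simp only [map_add, map_smul, smul_eq_mul]
  set a := f (1, 0)
  set b := f (0, 1)
  have hab : a ^ 2 + b ^ 2 ≠ 0 := by
    intro h0
    have ha : a = 0 := by nlinarith [sq_nonneg a, sq_nonneg b]
    have hb : b = 0 := by nlinarith [sq_nonneg a, sq_nonneg b]
    apply hf
    apply LinearMap.ext
    intro x
    rw [hx, ha, hb]
    simp
  refine ⟨fun x => a * x.2 - b * x.1, by fun_prop, ?_⟩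
  intro x y h1 h2
  rw [hx x, hx y] at h1
  dsimp only at h2
  ext
  · apply mul_left_cancel₀ hab
    linear_combination a * h1 - b * h2
  · apply mul_left_cancel₀ hab
    linear_combination b * h1 + a * h2

/-- There is a proper leveling of the tree `T₀` into four levels for which `T₀` is
region-level nonplanar: for every choice of three parallel lines in the plane, no planar
straight-line drawing of `T₀` places each vertex inside the open region prescribed by its
level. -/
theorem T₀_region_level_nonplanar :
    ∃ φ : Fin 10 → Fin 4,
      (∀ a b : Fin 10, T₀.Adj a b → φ a ≠ φ b) ∧
      ∀ (f : (ℝ × ℝ) →ₗ[ℝ] ℝ), f ≠ 0 → ∀ c₁ c₂ c₃ : ℝ, c₁ < c₂ → c₂ < c₃ →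
        ¬ ∃ p : Fin 10 → ℝ × ℝ,
            IsPlanarDrawing T₀ p ∧ ∀ j : Fin 10, p j ∈ levelRegion f c₁ c₂ c₃ (φ j) := by
  refine ⟨![1, 2, 2, 2, 3, 3, 3, 0, 0, 0], ?_, ?_⟩
  · intro a b h
    simp only [T₀, SimpleGraph.fromEdgeSet_adj] at h
    revert a b
    simp only [Set.mem_insert_iff, Set.mem_singleton_iff]
    decide
  rintro f hf c₁ c₂ c₃ h12 h23 ⟨p, ⟨-, hpl⟩, hp⟩
  obtain ⟨g, gc, hg⟩ := exists_coord f hf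
  -- disjoint edges have disjoint segments
  have hdis : ∀ a b c d : Fin 10, T₀.Adj a b → T₀.Adj c d → a ≠ c → a ≠ d → b ≠ c → b ≠ d →
      ∀ x, x ∈ segment ℝ (p a) (p b) → x ∈ segment ℝ (p c) (p d) → False := by
    intro a b c d h1 h2 n1 n2 n3 n4 x hx hy
    have hne : s(a, b) ≠ s(c, d) := by
      simp [n1, n2]
    obtain ⟨z, ⟨hz1, hz2⟩, -⟩ := hpl a b c d h1 h2 hne ⟨hx, hy⟩
    simp only [Set.mem_insert_iff, Set.mem_singleton_iff] at hz1 hz2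
    rcases hz1 with rfl | rfl <;> rcases hz2 with rfl | rfl <;> contradiction
  -- children are 1, 2, 3, with upper leaves `hi` and lower leaves `lo`
  let ch : Fin 3 → Fin 10 := ![1, 2, 3]
  let hi : Fin 3 → Fin 10 := ![4, 5, 6]
  let lo : Fin 3 → Fin 10 := ![7, 8, 9]
  have a0 : ∀ i, T₀.Adj 0 (ch i) := by
    intro i; fin_cases i <;> simp [T₀, ch]
  have a1 : ∀ i, T₀.Adj (ch i) (hi i) := by
    intro i; fin_cases i <;> simp [T₀, ch, hi]
  have a2 : ∀ i, T₀.Adj (ch i) (lo i) := by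
    intro i; fin_cases i <;> simp [T₀, ch, lo]
  have r0 : c₁ < f (p 0) ∧ f (p 0) < c₂ := hp 0
  have r1 : ∀ i, c₂ < f (p (ch i)) ∧ f (p (ch i)) < c₃ := by
    intro i; fin_cases i
    · exact hp 1
    · exact hp 2
    · exact hp 3
  have r2 : ∀ i, c₃ < f (p (hi i)) := by
    intro i; fin_cases i
    · exact hp 4
    · exact hp 5
    · exact hp 6
  have r3 : ∀ i, f (p (lo i)) < c₁ := by
    intro i; fin_cases i
    · exact hp 7
    · exact hp 8
    · exact hp 9
  have hX := fun i => path_curve f (p (lo i)) (p (ch i)) (p (hi i))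
    (by linarith [r3 i, r1 i]) (by linarith [r2 i, r1 i])
  choose X Xc Xf XC Xs using hX
  have hY := fun i => seg_curve f (p 0) (p (ch i)) (by linarith [r1 i])
  choose Y Yc Yf Y0 YC Ys using hY
  have hXX : ∀ i j, i ≠ j → ∀ t ∈ Set.Icc c₁ c₃, g (X i t) ≠ g (X j t) := by
    intro i j hij t ht e
    have e' : X i t = X j t := hg _ _ (by rw [Xf, Xf]) e
    have n : ch i ≠ ch j ∧ ch i ≠ hi j ∧ ch i ≠ lo j ∧ hi i ≠ ch j ∧ hi i ≠ hi j ∧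
        hi i ≠ lo j ∧ lo i ≠ ch j ∧ lo i ≠ hi j ∧ lo i ≠ lo j := by
      clear e e'; revert i j; decide
    obtain ⟨n1, n2, n3, n4, n5, n6, n7, n8, n9⟩ := n
    have s1 := Xs i t (by linarith [r3 i, ht.1]) (by linarith [r2 i, ht.2])
    have s2 := Xs j t (by linarith [r3 j, ht.1]) (by linarith [r2 j, ht.2])
    rw [e'] at s1
    rcases s1 with s1 | s1 <;> rcases s2 with s2 | s2
    · exact hdis _ _ _ _ (a2 i) (a2 j) n1 n3 n7 n9 _ s1 s2
    · exact hdis _ _ _ _ (a2 i) (a1 j) n1 n2 n7 n8 _ s1 s2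
    · exact hdis _ _ _ _ (a1 i) (a2 j) n1 n3 n4 n6 _ s1 s2
    · exact hdis _ _ _ _ (a1 i) (a1 j) n1 n2 n4 n5 _ s1 s2
  have hYX : ∀ k j, k ≠ j → ∀ t ∈ Set.Icc (f (p 0)) (f (p (ch k))), g (Y k t) ≠ g (X j t) := by
    intro k j hkj t ht e
    have e' : Y k t = X j t := hg _ _ (by rw [Yf, Xf]) e
    have n : ch k ≠ ch j ∧ ch k ≠ hi j ∧ ch k ≠ lo j ∧ 0 ≠ ch j ∧ 0 ≠ hi j ∧ 0 ≠ lo j := by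
      clear e e' ht; revert k j; decide
    obtain ⟨n1, n2, n3, n4, n5, n6⟩ := n
    have s1 := Ys k t ht.1 ht.2
    have s2 := Xs j t (by linarith [r3 j, ht.1]) (by linarith [r2 j, ht.2, r1 k])
    rw [e'] at s1
    rcases s2 with s2 | s2
    · exact hdis _ _ _ _ (a0 k) (a2 j) n4 n6 n1 n3 _ s1 s2
    · exact hdis _ _ _ _ (a0 k) (a1 j) n4 n5 n1 n2 _ s1 s2
  -- the side of path `j` on which path `k` lies is the side on which the root lies
  have key : ∀ k j, k ≠ j → (g (X k c₁) < g (X j c₁) ↔ g (p 0) < g (X j (f (p 0)))) := by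
    intro k j hkj
    have k1 := same_side_iff (fun t => g (X k t)) (fun t => g (X j t)) (gc.comp (Xc k))
      (gc.comp (Xc j)) c₁ c₃ c₁ (f (p (ch k))) ⟨le_rfl, by linarith⟩
      ⟨by linarith [r1 k], by linarith [r1 k]⟩ (hXX k j hkj)
    have k2 := same_side_iff (fun t => g (Y k t)) (fun t => g (X j t)) (gc.comp (Yc k))
      (gc.comp (Xc j)) (f (p 0)) (f (p (ch k))) (f (p 0)) (f (p (ch k)))
      ⟨le_rfl, by linarith [r1 k]⟩ ⟨by linarith [r1 k], le_rfl⟩ (hYX k j hkj)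
    simp only [XC, Y0, YC] at k1 k2
    exact k1.trans k2.symm
  have m : c₁ ∈ Set.Icc c₁ c₃ := ⟨le_rfl, by linarith⟩
  have d01 := hXX 0 1 (by decide) c₁ m
  have d02 := hXX 0 2 (by decide) c₁ m
  have d12 := hXX 1 2 (by decide) c₁ m
  have e0 := (key 1 0 (by decide)).trans (key 2 0 (by decide)).symm
  have e1 := (key 0 1 (by decide)).trans (key 2 1 (by decide)).symm
  have e2 := (key 0 2 (by decide)).trans (key 1 2 (by decide)).symm
  grind
end
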